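/- arXiv:1907.12043 — 2 statements merged into one kernel-verified Lean document; each statement's English description precedes it below -/
import Mathlib

section
/- Let H be a fixed graph on r vertices, p_0 = (ln n − 2 ln ln n)/m_1(H), and p_2^+ = p_2^+(H). Couple G(H,n,p_0) ⊆ G(H,n,p_2^+) so that every copy of H present in G(H,n,p_0) is present in G(H,n,p_2^+). Then with probability tending to 1 as n → ∞, for every pair of distinct vertices u,v ∈ SMALL there do not exist ℓ ≤ 6 copies of H present in G(H,n,p_2^+) whose union is connected and contains both u and v; consequently, w.h.p. every pair of distinct vertices of SMALL is at graph distance at least 7 in G(H,n,p_2^+). -/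
open Filter

namespace RandomMotif

/-- `G` is a *copy* of `H` in the complete graph on `Fin n`: the image of `H`
under an injection of its vertices into `Fin n`. -/
def IsCopy {k n : ℕ} (H : SimpleGraph (Fin k)) (G : SimpleGraph (Fin n)) : Prop :=
  ∃ f : Fin k ↪ Fin n, G = H.map f

/-- The type of copies of `H` in `K_n`. -/
abbrev Copy {k : ℕ} (H : SimpleGraph (Fin k)) (n : ℕ) : Type :=
  {G : SimpleGraph (Fin n) // IsCopy H G}

/-- The graph spanned by the selected copies. -/
noncomputable def graphOf {k n : ℕ} {H : SimpleGraph (Fin k)} (ω : Copy H n → Bool) :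
    SimpleGraph (Fin n) :=
  ⨆ c : Copy H n, if ω c then c.1 else ⊥

open Classical in
/-- The probability, in the binomial random motif model `G(H,n,p)` (each copy of `H`
in `K_n` is included independently with probability `p`), of the event `P` on the
family of selected copies. -/
noncomputable def selProb {k : ℕ} (H : SimpleGraph (Fin k)) (n : ℕ) (p : ℝ)
    (P : (Copy H n → Bool) → Prop) : ℝ :=
  ∑ ω : Copy H n → Bool,
    (∏ c : Copy H n, if ω c then p else 1 - p) * (if P ω then 1 else 0)

/-- The probability that `G(H,n,p)` satisfies the graph predicate `Q`. -/
noncomputable def motifProb {k : ℕ} (H : SimpleGraph (Fin k)) (n : ℕ) (p : ℝ)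
    (Q : SimpleGraph (Fin n) → Prop) : ℝ :=
  selProb H n p (fun ω => Q (graphOf ω))

/-- `mr H n r` is the number of copies of `H` in `K_n` whose vertex set meets
`[r] = {0,…,r-1}`. -/
noncomputable def mr {k : ℕ} (H : SimpleGraph (Fin k)) (n r : ℕ) : ℕ :=
  Nat.card {G : SimpleGraph (Fin n) // IsCopy H G ∧ ∃ v ∈ G.support, (v : ℕ) < r}

/-- The minimum degree `δ(H)`. -/
noncomputable def minDeg {k : ℕ} (H : SimpleGraph (Fin k)) : ℕ :=
  ⨅ v, (H.neighborSet v).ncard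

/-- `δ_d(H) = ⌈d / δ(H)⌉ - 1`. -/
noncomputable def deltad {k : ℕ} (H : SimpleGraph (Fin k)) (d : ℕ) : ℕ :=
  ⌈(d : ℝ) / (minDeg H : ℝ)⌉₊ - 1

/-- `p_d^-(H) = (ln n + δ_d(H) ln ln n - x(n)) / m_1(H)`, where `x` is a fixed
function with `1 ≪ x(n) ≪ ln ln n`. -/
noncomputable def pMinus {k : ℕ} (H : SimpleGraph (Fin k)) (d : ℕ) (x : ℕ → ℝ) (n : ℕ) : ℝ :=
  (Real.log n + (deltad H d) * Real.log (Real.log n) - x n) / (mr H n 1)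

/-- `p_d^+(H) = (ln n + δ_d(H) ln ln n + x(n)) / m_1(H)`, where `x` is a fixed
function with `1 ≪ x(n) ≪ ln ln n`. -/
noncomputable def pPlus {k : ℕ} (H : SimpleGraph (Fin k)) (d : ℕ) (x : ℕ → ℝ) (n : ℕ) : ℝ :=
  (Real.log n + (deltad H d) * Real.log (Real.log n) + x n) / (mr H n 1)

/-- The number of selected copies of `H` containing the vertex `v`. -/
noncomputable def copyCount {k n : ℕ} {H : SimpleGraph (Fin k)}
    (ω : Copy H n → Bool) (v : Fin n) : ℕ :=
  Nat.card {c : Copy H n // ω c = true ∧ v ∈ c.1.support}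

/-- `SMALL`: the set of vertices lying on fewer than `ln ln n` of the selected
copies of `H`. -/
noncomputable def Small {k n : ℕ} {H : SimpleGraph (Fin k)}
    (ω : Copy H n → Bool) : Set (Fin n) :=
  {v : Fin n | (copyCount ω v : ℝ) < Real.log (Real.log n)}

/-- `LARGE`: the set of vertices lying on at least `ln ln n` of the selected
copies of `H`. -/
noncomputable def Large {k n : ℕ} {H : SimpleGraph (Fin k)}
    (ω : Copy H n → Bool) : Set (Fin n) :=
  {v : Fin n | Real.log (Real.log n) ≤ (copyCount ω v : ℝ)}

/-- `p_0 = (ln n - 2 ln ln n) / m_1(H)`. -/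
noncomputable def pZero {k : ℕ} (H : SimpleGraph (Fin k)) (n : ℕ) : ℝ :=
  (Real.log n - 2 * Real.log (Real.log n)) / (mr H n 1)

/-- The joint law of a single copy under the monotone coupling of `G(H,n,p)` and
`G(H,n,q)` (for `p ≤ q`): the first component is the indicator that the copy is
present in `G(H,n,p)`, the second that it is present in `G(H,n,q)`, and the first
implies the second almost surely. -/
noncomputable def pairWeight (p q : ℝ) : Bool × Bool → ℝ
  | (true, true) => p
  | (false, true) => q - p
  | (false, false) => 1 - q
  | (true, false) => 0

open Classical in
/-- The probability, under the (independent over copies) monotone coupling of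
`G(H,n,p) ⊆ G(H,n,q)`, of the event `P` on the pair of selections. -/
noncomputable def coupleProb {k : ℕ} (H : SimpleGraph (Fin k)) (n : ℕ) (p q : ℝ)
    (P : (Copy H n → Bool) → (Copy H n → Bool) → Prop) : ℝ :=
  ∑ ω : Copy H n → Bool × Bool,
    (∏ c : Copy H n, pairWeight p q (ω c)) *
      (if P (fun c => (ω c).1) (fun c => (ω c).2) then 1 else 0)

/-- The expected value of a product of functions of the single copies factorises. -/
lemma sum_prod_pairWeight_mul {ι : Type*} [Fintype ι] [DecidableEq ι] (p q : ℝ)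
    (g : ι → Bool × Bool → ℝ) :
    ∑ ω : ι → Bool × Bool, (∏ c, pairWeight p q (ω c)) * ∏ c, g c (ω c) =
      ∏ c, ∑ b, pairWeight p q b * g c b := by
  simp_rw [← Finset.prod_mul_distrib]
  rw [Finset.prod_univ_sum, Fintype.piFinset_univ]

lemma pairWeight_nonneg {p q : ℝ} (hp : 0 ≤ p) (hpq : p ≤ q) (hq : q ≤ 1) (b : Bool × Bool) :
    0 ≤ pairWeight p q b := by
  rcases b with ⟨_ | _, _ | _⟩ <;> simp [pairWeight] <;> linarith

lemma sum_pairWeight_mul (p q : ℝ) (g : Bool × Bool → ℝ) :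
    ∑ b, pairWeight p q b * g b =
      p * g (true, true) + (q - p) * g (false, true) + (1 - q) * g (false, false) := by
  simp [Fintype.sum_prod_type, pairWeight]
  ring

section Coupling

variable {k n : ℕ} {H : SimpleGraph (Fin k)} {p q : ℝ}

lemma coupleProb_mono (hp : 0 ≤ p) (hpq : p ≤ q) (hq : q ≤ 1)
    {P Q : (Copy H n → Bool) → (Copy H n → Bool) → Prop} (h : ∀ a b, P a b → Q a b) :
    coupleProb H n p q P ≤ coupleProb H n p q Q := by
  classical
  unfold coupleProb
  refine Finset.sum_le_sum fun ω _ => mul_le_mul_of_nonneg_left ?_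
    (Finset.prod_nonneg fun c _ => pairWeight_nonneg hp hpq hq _)
  split_ifs with h1 h2 <;> first | exact absurd (h _ _ h1) h2 | norm_num

lemma coupleProb_nonneg (hp : 0 ≤ p) (hpq : p ≤ q) (hq : q ≤ 1)
    (P : (Copy H n → Bool) → (Copy H n → Bool) → Prop) : 0 ≤ coupleProb H n p q P := by
  classical
  unfold coupleProb
  refine Finset.sum_nonneg fun ω _ => mul_nonneg
    (Finset.prod_nonneg fun c _ => pairWeight_nonneg hp hpq hq _) ?_
  split_ifs <;> norm_num

lemma coupleProb_not (P : (Copy H n → Bool) → (Copy H n → Bool) → Prop) :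
    coupleProb H n p q P = 1 - coupleProb H n p q (fun a b => ¬ P a b) := by
  classical
  have key : ∑ ω : Copy H n → Bool × Bool, (∏ c : Copy H n, pairWeight p q (ω c)) = 1 := by
    have := sum_prod_pairWeight_mul (ι := Copy H n) p q (fun _ _ => 1)
    simp only [Finset.prod_const_one, mul_one] at this
    rw [this]
    refine Finset.prod_eq_one fun c _ => ?_
    have := sum_pairWeight_mul p q (fun _ => 1)
    simp only [mul_one] at this
    rw [this]; ring
  rw [eq_sub_iff_add_eq, ← key]
  unfold coupleProb
  rw [← Finset.sum_add_distrib]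
  refine Finset.sum_congr rfl fun ω _ => ?_
  by_cases h : P (fun c => (ω c).1) (fun c => (ω c).2) <;> simp [h]

lemma coupleProb_exists_le (hp : 0 ≤ p) (hpq : p ≤ q) (hq : q ≤ 1) {ι : Type*} (s : Finset ι)
    (P : ι → (Copy H n → Bool) → (Copy H n → Bool) → Prop) :
    coupleProb H n p q (fun a b => ∃ i ∈ s, P i a b) ≤ ∑ i ∈ s, coupleProb H n p q (P i) := by
  classical
  unfold coupleProb
  rw [Finset.sum_comm]
  refine Finset.sum_le_sum fun ω _ => ?_
  rw [← Finset.mul_sum]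
  refine mul_le_mul_of_nonneg_left ?_
    (Finset.prod_nonneg fun c _ => pairWeight_nonneg hp hpq hq _)
  have h0 : ∀ i ∈ s, (0 : ℝ) ≤ if P i (fun c => (ω c).1) (fun c => (ω c).2) then 1 else 0 :=
    fun i _ => by split_ifs <;> norm_num
  split_ifs with h
  · obtain ⟨i, hi, hP⟩ := h
    simpa [hP] using Finset.single_le_sum h0 hi
  · exact Finset.sum_nonneg h0

open Classical in
/-- Exponential Markov bound: all copies in `S` are selected by the larger selection while
fewer than `K` copies in `A` are selected by the smaller one. -/
lemma coupleProb_forall_and_card_lt_le (hp : 0 ≤ p) (hpq : p ≤ q) (hq : q ≤ 1)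
    (S A : Finset (Copy H n)) (K : ℝ) :
    coupleProb H n p q (fun ω₀ ω₂ => (∀ c ∈ S, ω₂ c = true) ∧
        (((A.filter fun c => ω₀ c = true).card : ℕ) : ℝ) < K) ≤
      Real.exp (2 * K) * (Real.exp 1 * q) ^ S.card *
        Real.exp (-(p * (1 - Real.exp (-2)) * A.card)) := by
  set θ : ℝ := Real.exp (-2) with hθ
  have hθ0 : 0 < θ := Real.exp_pos _
  have hθ1 : θ ≤ 1 := Real.exp_le_one_iff.2 (by norm_num)
  let g : Copy H n → Bool × Bool → ℝ := fun c b =>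
    (if c ∈ S then (if b.2 = true then 1 else 0) else 1) *
      (if c ∈ A ∧ b.1 = true then θ else 1)
  have hg0 : ∀ c b, 0 ≤ g c b := fun c b =>
    mul_nonneg (by split_ifs <;> norm_num) (by split_ifs <;> linarith)
  have hind : ∀ ω : Copy H n → Bool × Bool,
      (if ((∀ c ∈ S, (ω c).2 = true) ∧
        (((A.filter fun c => (ω c).1 = true).card : ℕ) : ℝ) < K) then (1 : ℝ) else 0) ≤
        Real.exp (2 * K) * ∏ c, g c (ω c) := by
    intro ω
    split_ifs with h
    · obtain ⟨h1, h2⟩ := h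
      have e1 : ∏ c, g c (ω c) = θ ^ (A.filter fun c => (ω c).1 = true).card := by
        rw [Finset.prod_mul_distrib, Finset.prod_eq_one, one_mul, ← Finset.prod_filter,
          Finset.prod_const]
        · congr 2; ext c; simp
        · intro c _
          split_ifs with hc hc' <;> first | rfl | exact absurd (h1 c hc) hc'
      rw [e1, hθ, ← Real.exp_nat_mul, ← Real.exp_add]
      apply Real.one_le_exp
      linarith
    · exact mul_nonneg (Real.exp_pos _).le (Finset.prod_nonneg fun c _ => hg0 _ _)
  have hfac : ∀ c, ∑ b, pairWeight p q b * g c b ≤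
      (if c ∈ S then Real.exp 1 * q else 1) *
        (if c ∈ A then Real.exp (-(p * (1 - θ))) else 1) := by
    intro c
    rw [sum_pairWeight_mul]
    have hexp : 1 - p * (1 - θ) ≤ Real.exp (-(p * (1 - θ))) := by
      have := Real.add_one_le_exp (-(p * (1 - θ))); linarith
    have hx1 : p * (1 - θ) ≤ 1 := by nlinarith
    have he1 : 1 ≤ Real.exp 1 := Real.one_le_exp (by norm_num)
    have he2 : 1 ≤ Real.exp 1 * Real.exp (-(p * (1 - θ))) := by
      rw [← Real.exp_add]; apply Real.one_le_exp; linarith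
    by_cases hS : c ∈ S <;> by_cases hA : c ∈ A <;> simp [g, hS, hA]
    · calc p * θ + (q - p) ≤ q * 1 := by nlinarith
        _ ≤ q * (Real.exp 1 * Real.exp (-(p * (1 - θ)))) :=
          mul_le_mul_of_nonneg_left he2 (by linarith)
        _ = _ := by ring
    · nlinarith
    · linarith
  calc coupleProb H n p q (fun ω₀ ω₂ => (∀ c ∈ S, ω₂ c = true) ∧
        (((A.filter fun c => ω₀ c = true).card : ℕ) : ℝ) < K)
      ≤ ∑ ω : Copy H n → Bool × Bool, (∏ c : Copy H n, pairWeight p q (ω c)) *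
          (Real.exp (2 * K) * ∏ c, g c (ω c)) := by
        unfold coupleProb
        refine Finset.sum_le_sum fun ω _ => mul_le_mul_of_nonneg_left ?_
          (Finset.prod_nonneg fun c _ => pairWeight_nonneg hp hpq hq _)
        simpa only using hind ω
    _ = Real.exp (2 * K) * ∏ c, ∑ b, pairWeight p q b * g c b := by
        rw [← sum_prod_pairWeight_mul, Finset.mul_sum]
        exact Finset.sum_congr rfl fun ω _ => by ring
    _ ≤ Real.exp (2 * K) * ∏ c, ((if c ∈ S then Real.exp 1 * q else 1) *
        (if c ∈ A then Real.exp (-(p * (1 - θ))) else 1)) := by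
        refine mul_le_mul_of_nonneg_left (Finset.prod_le_prod (fun c _ => ?_) fun c _ => hfac c)
          (Real.exp_pos _).le
        exact Finset.sum_nonneg fun b _ => mul_nonneg (pairWeight_nonneg hp hpq hq _) (hg0 _ _)
    _ = _ := by
        rw [Finset.prod_mul_distrib, Finset.prod_ite_mem, Finset.prod_ite_mem, Finset.univ_inter,
          Finset.univ_inter, Finset.prod_const, Finset.prod_const, ← Real.exp_nat_mul, mul_assoc]
        congr 3
        ring

end Coupling

section Counting

variable {k n : ℕ} {H : SimpleGraph (Fin k)}

open Classical in
/-- The copies of `H` containing the vertex `u`. -/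
noncomputable def copiesAt (H : SimpleGraph (Fin k)) (u : Fin n) : Finset (Copy H n) :=
  Finset.univ.filter fun c => u ∈ c.1.support

@[simp] lemma mem_copiesAt {u : Fin n} {c : Copy H n} :
    c ∈ copiesAt H u ↔ u ∈ c.1.support := by
  simp [copiesAt]

open Classical in
/-- The vertices of a copy of `H`. -/
noncomputable def verts (c : Copy H n) : Finset (Fin n) :=
  Finset.univ.filter fun v => v ∈ c.1.support

@[simp] lemma mem_verts {v : Fin n} {c : Copy H n} : v ∈ verts c ↔ v ∈ c.1.support := by
  simp [verts]

lemma card_verts_le (c : Copy H n) : (verts c).card ≤ k := by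
  classical
  obtain ⟨f, hf⟩ := c.2
  have : verts c ⊆ Finset.univ.map f := by
    intro v hv
    rw [mem_verts, hf, SimpleGraph.mem_support] at hv
    obtain ⟨w, -, a, b, -, rfl, -⟩ := hv
    simp
  simpa using Finset.card_le_card this

/-- The action of a vertex permutation on the copies of `H`. -/
def permCopy (σ : Equiv.Perm (Fin n)) (c : Copy H n) : Copy H n :=
  ⟨c.1.map σ.toEmbedding, by
    obtain ⟨f, hf⟩ := c.2
    exact ⟨f.trans σ.toEmbedding, by rw [hf, SimpleGraph.map_map]; rfl⟩⟩

lemma permCopy_injective (σ : Equiv.Perm (Fin n)) :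
    Function.Injective (permCopy σ : Copy H n → Copy H n) := by
  intro c d h
  exact Subtype.ext (SimpleGraph.map_injective _ (congrArg Subtype.val h))

lemma apply_mem_support_permCopy (σ : Equiv.Perm (Fin n)) {c : Copy H n} {u : Fin n}
    (hu : u ∈ c.1.support) : σ u ∈ (permCopy σ c).1.support := by
  rw [SimpleGraph.mem_support] at hu ⊢
  obtain ⟨w, hw⟩ := hu
  exact ⟨σ w, σ.injective.ne hw.ne, u, w, hw, rfl, rfl⟩

lemma card_copiesAt_le (u v : Fin n) : (copiesAt H u).card ≤ (copiesAt H v).card := by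
  refine Finset.card_le_card_of_injOn (permCopy (Equiv.swap u v)) (fun c hc => ?_)
    (permCopy_injective _).injOn
  have := apply_mem_support_permCopy (Equiv.swap u v) (mem_copiesAt.1 hc)
  rw [Equiv.swap_apply_left] at this
  exact mem_copiesAt.2 this

lemma card_copiesAt (u : Fin n) : (copiesAt H u).card = mr H n 1 := by
  classical
  have hn : 0 < n := u.pos
  rw [(card_copiesAt_le u ⟨0, hn⟩).antisymm (card_copiesAt_le _ _), mr,
    ← Nat.card_eq_finsetCard]
  refine Nat.card_congr ⟨fun c => ⟨c.1.1, c.1.2, ⟨0, hn⟩, mem_copiesAt.1 c.2, by simp⟩,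
    fun G => ⟨⟨G.1, G.2.1⟩, mem_copiesAt.2 ?_⟩, fun _ => rfl, fun _ => rfl⟩
  obtain ⟨v, hv, hv1⟩ := G.2.2
  have : v = ⟨0, hn⟩ := Fin.ext (by simpa using hv1)
  exact this ▸ hv

lemma exists_perm_pair {α : Type*} [DecidableEq α] {a b u v : α} (hab : a ≠ b) (huv : u ≠ v) :
    ∃ σ : Equiv.Perm α, σ a = u ∧ σ b = v := by
  refine ⟨(Equiv.swap a u).trans (Equiv.swap (Equiv.swap a u b) v), ?_, by simp⟩
  have h : u ≠ Equiv.swap a u b := fun h => hab ((Equiv.swap a u).injective (by simpa using h))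
  simp [Equiv.swap_apply_of_ne_of_ne h huv]

open Classical in
lemma card_copiesAt_inter_le {a b u v : Fin n} (hab : a ≠ b) (huv : u ≠ v) :
    (copiesAt H a ∩ copiesAt H b).card ≤ (copiesAt H u ∩ copiesAt H v).card := by
  obtain ⟨σ, rfl, rfl⟩ := exists_perm_pair hab huv
  refine Finset.card_le_card_of_injOn (permCopy σ) (fun c hc => ?_) (permCopy_injective _).injOn
  simp only [Finset.coe_inter, Set.mem_inter_iff, Finset.mem_coe, mem_copiesAt] at hc ⊢
  exact ⟨apply_mem_support_permCopy σ hc.1, apply_mem_support_permCopy σ hc.2⟩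

open Classical in
/-- Double counting of the pairs `(w, c)` with `w ≠ u` and `u`, `w` both on `c`. -/
lemma card_copiesAt_inter_mul_le {u v : Fin n} (huv : u ≠ v) :
    (n - 1) * (copiesAt H u ∩ copiesAt H v).card ≤ (k - 1) * mr H n 1 := by
  calc (n - 1) * (copiesAt H u ∩ copiesAt H v).card
      = ∑ _w ∈ Finset.univ.erase u, (copiesAt H u ∩ copiesAt H v).card := by simp
    _ ≤ ∑ w ∈ Finset.univ.erase u, (copiesAt H u ∩ copiesAt H w).card :=
        Finset.sum_le_sum fun w hw =>
          card_copiesAt_inter_le huv (Finset.ne_of_mem_erase hw).symm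
    _ = ∑ c ∈ copiesAt H u, ((verts c).erase u).card := by
        simp_rw [Finset.card_eq_sum_ones]
        refine Finset.sum_comm' fun w c => ?_
        simp
        tauto
    _ ≤ ∑ _c ∈ copiesAt H u, (k - 1) := Finset.sum_le_sum fun c hc => by
        rw [Finset.card_erase_of_mem (mem_verts.2 (mem_copiesAt.1 hc))]
        exact Nat.sub_le_sub_right (card_verts_le c) 1
    _ = (k - 1) * mr H n 1 := by rw [Finset.sum_const, card_copiesAt, smul_eq_mul, mul_comm]

open Classical in
lemma card_copiesAt_inter_pos (hk : 0 < k) (hiso : ∀ v, (H.neighborSet v).Nonempty) (hkn : k ≤ n)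
    {u v : Fin n} (huv : u ≠ v) : 0 < (copiesAt H u ∩ copiesAt H v).card := by
  obtain ⟨b, hb⟩ := hiso ⟨0, hk⟩
  rw [SimpleGraph.mem_neighborSet] at hb
  let f := Fin.castLEEmb hkn
  have hne : f ⟨0, hk⟩ ≠ f b := f.injective.ne hb.ne
  refine lt_of_lt_of_le (Finset.card_pos.2 ⟨⟨H.map f, f, rfl⟩, ?_⟩) (card_copiesAt_inter_le hne huv)
  simp only [Finset.mem_inter, mem_copiesAt, SimpleGraph.mem_support]
  exact ⟨⟨_, hne, _, _, hb, rfl, rfl⟩, ⟨_, hne.symm, _, _, hb.symm, rfl, rfl⟩⟩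

lemma le_mul_mr (hk : 0 < k) (hiso : ∀ v, (H.neighborSet v).Nonempty) (hkn : k ≤ n)
    (hn : 2 ≤ n) : n - 1 ≤ (k - 1) * mr H n 1 := by
  classical
  have huv : (⟨0, by omega⟩ : Fin n) ≠ ⟨1, by omega⟩ := by simp
  have h1 := card_copiesAt_inter_mul_le (H := H) huv
  have h2 := card_copiesAt_inter_pos hk hiso hkn huv
  exact (Nat.le_mul_of_pos_right _ h2).trans h1

open Classical in
lemma three_mul_mr_le (hn : 2 * k ≤ n) {u v : Fin n} (huv : u ≠ v) :
    3 * mr H n 1 ≤ 2 * (copiesAt H u ∪ copiesAt H v).card := by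
  have h1 := card_copiesAt_inter_mul_le (H := H) huv
  have h2 := Finset.card_union_add_card_inter (copiesAt H u) (copiesAt H v)
  rw [card_copiesAt, card_copiesAt] at h2
  set I := (copiesAt H u ∩ copiesAt H v).card
  have h3 : 2 * I ≤ mr H n 1 := by
    rcases Nat.eq_zero_or_pos k with rfl | hk
    · have h4 : 1 < n := by have := u.2; have := v.2; have := Fin.val_ne_of_ne huv; omega
      have : I = 0 := by
        have : (n - 1) * I = 0 := by simpa using h1
        rcases Nat.mul_eq_zero.1 this with h | h <;> omega
      omega
    · rcases Nat.lt_or_ge 1 k with hk1 | hk1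
      · have : (k - 1) * (2 * I) ≤ (k - 1) * mr H n 1 := by
          refine le_trans ?_ h1
          rw [← mul_assoc]
          exact Nat.mul_le_mul_right _ (by omega)
        exact Nat.le_of_mul_le_mul_left this (by omega)
      · have h4 : 1 < n := by omega
        have : I = 0 := by
          have : (n - 1) * I = 0 := by
            have : k - 1 = 0 := by omega
            simpa [this] using h1
          rcases Nat.mul_eq_zero.1 this with h | h <;> omega
        omega
  omega

open Classical in
/-- Sequences of `ℓ` copies, consecutive ones sharing a vertex, the first one containing the
start vertex, together with a vertex of the last one. -/
noncomputable def chains (H : SimpleGraph (Fin k)) :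
    ℕ → Fin n → Finset (List (Copy H n) × Fin n)
  | 0, u => {([], u)}
  | ℓ + 1, u => (copiesAt H u).biUnion fun c => (verts c).biUnion fun w =>
      (chains H ℓ w).image fun x => (c :: x.1, x.2)

lemma cons_mem_chains {ℓ : ℕ} {u v w : Fin n} {c : Copy H n} {l : List (Copy H n)}
    (hu : u ∈ c.1.support) (hw : w ∈ c.1.support) (h : (l, v) ∈ chains H ℓ w) :
    (c :: l, v) ∈ chains H (ℓ + 1) u := by
  classical
  simp only [chains, Finset.mem_biUnion, Finset.mem_image]
  exact ⟨c, mem_copiesAt.2 hu, w, mem_verts.2 hw, (l, v), h, rfl⟩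

lemma exists_of_mem_chains_succ {ℓ : ℕ} {u v : Fin n} {l : List (Copy H n)}
    (h : (l, v) ∈ chains H (ℓ + 1) u) : ∃ c w l', l = c :: l' ∧ u ∈ c.1.support ∧
      w ∈ c.1.support ∧ (l', v) ∈ chains H ℓ w := by
  classical
  simp only [chains, Finset.mem_biUnion, Finset.mem_image] at h
  obtain ⟨c, hc, w, hw, x, hx, he⟩ := h
  obtain ⟨rfl, rfl⟩ := Prod.mk.inj he
  exact ⟨c, w, x.1, rfl, mem_copiesAt.1 hc, mem_verts.1 hw, hx⟩

lemma length_eq_of_mem_chains {ℓ : ℕ} {u v : Fin n} {l : List (Copy H n)}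
    (h : (l, v) ∈ chains H ℓ u) : l.length = ℓ := by
  induction ℓ generalizing u l with
  | zero => simp [chains] at h; simp [h.1]
  | succ ℓ ih =>
    obtain ⟨c, w, l', rfl, -, -, h'⟩ := exists_of_mem_chains_succ h
    simp [ih h']

lemma card_chains_le (ℓ : ℕ) (u : Fin n) : (chains H ℓ u).card ≤ (mr H n 1 * k) ^ ℓ := by
  classical
  induction ℓ generalizing u with
  | zero => simp [chains]
  | succ ℓ ih =>
    rw [chains, pow_succ', mul_assoc]
    nth_rw 1 [← card_copiesAt u]
    refine Finset.card_biUnion_le_card_mul (copiesAt H u) _ _ fun c _ => ?_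
    refine le_trans ?_ (Nat.mul_le_mul_right _ (card_verts_le c))
    exact Finset.card_biUnion_le_card_mul (verts c) _ _ fun w _ => Finset.card_image_le.trans (ih w)

/-- A chain can be restarted at any of its copies, from any vertex of that copy. -/
lemma exists_suffix_mem_chains {ℓ : ℕ} {u u' v : Fin n} {c : Copy H n} {l₁ l₂ : List (Copy H n)}
    (h : (l₁ ++ c :: l₂, v) ∈ chains H ℓ u') (hu : u ∈ c.1.support) :
    ∃ m, (c :: l₂, v) ∈ chains H m u := by
  induction l₁ generalizing ℓ u' with
  | nil =>
    cases ℓ with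
    | zero => simp [chains] at h
    | succ ℓ =>
      obtain ⟨d, w, l', he, -, hw, h'⟩ := exists_of_mem_chains_succ h
      obtain ⟨rfl, rfl⟩ := List.cons.inj he
      exact ⟨_, cons_mem_chains hu hw h'⟩
  | cons d l₁ ih =>
    cases ℓ with
    | zero => simp [chains] at h
    | succ ℓ =>
      obtain ⟨d', w, l', he, -, hw, h'⟩ := exists_of_mem_chains_succ h
      obtain ⟨rfl, rfl⟩ := List.cons.inj he
      exact ih h'

lemma sup_adj {𝒞 : Finset (Copy H n)} {a b : Fin n} :
    (𝒞.sup Subtype.val).Adj a b ↔ ∃ c ∈ 𝒞, c.1.Adj a b := by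
  classical
  induction 𝒞 using Finset.induction_on with
  | empty => simp
  | insert c s hc ih => simp [Finset.sup_insert, ih]

/-- Vertices joined inside a union of copies are joined by a chain of distinct copies among
them. -/
lemma exists_nodup_mem_chains {𝒞 : Finset (Copy H n)} {u v : Fin n}
    (h : (𝒞.sup Subtype.val).Reachable u v) :
    ∃ m l, (l, v) ∈ chains H m u ∧ l.Nodup ∧ ∀ c ∈ l, c ∈ 𝒞 := by
  obtain ⟨w⟩ := h
  induction w with
  | nil => exact ⟨0, [], by simp [chains], by simp, by simp⟩
  | cons hadj _ ih =>
    obtain ⟨m, l, hl, hnd, hsub⟩ := ih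
    obtain ⟨c, hc, hab⟩ := sup_adj.1 hadj
    by_cases hcl : c ∈ l
    · obtain ⟨l₁, l₂, rfl⟩ := List.append_of_mem hcl
      obtain ⟨m', hm'⟩ := exists_suffix_mem_chains hl ⟨_, hab⟩
      exact ⟨m', _, hm', (List.nodup_append.1 hnd).2.1,
        fun d hd => hsub d (List.mem_append_right _ hd)⟩
    · refine ⟨m + 1, c :: l, cons_mem_chains ⟨_, hab⟩ ⟨_, hab.symm⟩ hl,
        List.nodup_cons.2 ⟨hcl, hnd⟩, ?_⟩
      simpa [hc] using hsub

/-- A walk in the graph of the selected copies runs inside the union of at most as many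
selected copies as its length. -/
lemma exists_reachable_of_walk {ω : Copy H n → Bool} {u v : Fin n} (w : (graphOf ω).Walk u v) :
    ∃ 𝒞 : Finset (Copy H n), 𝒞.card ≤ w.length ∧ (∀ c ∈ 𝒞, ω c = true) ∧
      (𝒞.sup Subtype.val).Reachable u v := by
  classical
  induction w with
  | nil => exact ⟨∅, by simp, by simp, SimpleGraph.Reachable.refl _⟩
  | cons hadj w ih =>
    obtain ⟨𝒞, hcard, hsel, hreach⟩ := ih
    rw [graphOf, SimpleGraph.iSup_adj] at hadj
    obtain ⟨c, hc⟩ := hadj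
    have hω : ω c = true := by
      by_contra h
      simp [h] at hc
    rw [if_pos hω] at hc
    refine ⟨insert c 𝒞, (Finset.card_insert_le _ _).trans (by simpa using hcard), ?_, ?_⟩
    · simpa [hω] using hsel
    · refine SimpleGraph.Reachable.trans (SimpleGraph.Adj.reachable ?_)
        (hreach.mono (Finset.sup_mono (Finset.subset_insert c 𝒞)))
      exact sup_adj.2 ⟨c, Finset.mem_insert_self _ _, hc⟩

lemma card_filter_union_le_copyCount [DecidableEq (Copy H n)] (ω : Copy H n → Bool)
    (u v : Fin n) :
    ((copiesAt H u ∪ copiesAt H v).filter fun c => ω c = true).card ≤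
      copyCount ω u + copyCount ω v := by
  classical
  have h : ∀ w : Fin n, copyCount ω w = ((copiesAt H w).filter fun c => ω c = true).card := by
    intro w
    rw [copyCount, ← Nat.card_eq_finsetCard]
    exact Nat.card_congr (Equiv.subtypeEquivRight fun c => by simp [and_comm])
  rw [h, h, Finset.filter_union]
  exact Finset.card_union_le _ _

/-- Some two distinct vertices of `SMALL` are joined inside a union of at most `6` copies
selected by `ω₂`. -/
def SmallLinked (ω₀ ω₂ : Copy H n → Bool) : Prop :=
  ∃ u v : Fin n, u ∈ Small ω₀ ∧ v ∈ Small ω₀ ∧ u ≠ v ∧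
    ∃ 𝒞 : Finset (Copy H n), 𝒞.card ≤ 6 ∧ (∀ c ∈ 𝒞, ω₂ c = true) ∧
      (𝒞.sup Subtype.val).Reachable u v

lemma exp_neg_two_le : Real.exp (-2) ≤ 1 / 5 := by
  have h : (5 : ℝ) ≤ Real.exp 2 := by
    have h1 := Real.exp_one_gt_d9
    have h2 : Real.exp 2 = Real.exp 1 * Real.exp 1 := by rw [← Real.exp_add]; norm_num
    rw [h2]; nlinarith
  rw [Real.exp_neg, ← one_div]
  exact one_div_le_one_div_of_le (by norm_num) h

open Classical in
lemma coupleProb_chain_le {p q : ℝ} (hp : 0 ≤ p) (hpq : p ≤ q) (hq : q ≤ 1) (hn : 2 * k ≤ n)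
    {u v : Fin n} (huv : u ≠ v) {l : List (Copy H n)} (hl : l.Nodup) :
    coupleProb H n p q (fun ω₀ ω₂ => u ∈ Small ω₀ ∧ v ∈ Small ω₀ ∧ ∀ c ∈ l, ω₂ c = true) ≤
      Real.exp (4 * Real.log (Real.log n)) * (Real.exp 1 * q) ^ l.length *
        Real.exp (-(6 / 5 * (p * mr H n 1))) := by
  refine (coupleProb_mono hp hpq hq (Q := fun ω₀ ω₂ => (∀ c ∈ l.toFinset, ω₂ c = true) ∧
    ((((copiesAt H u ∪ copiesAt H v).filter fun c => ω₀ c = true).card : ℕ) : ℝ) <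
      2 * Real.log (Real.log n)) ?_).trans
    ((coupleProb_forall_and_card_lt_le hp hpq hq _ _ _).trans ?_)
  · rintro ω₀ ω₂ ⟨hu, hv, hsel⟩
    refine ⟨by simpa using hsel, ?_⟩
    have h1 : ((((copiesAt H u ∪ copiesAt H v).filter fun c => ω₀ c = true).card : ℕ) : ℝ) ≤
        copyCount ω₀ u + copyCount ω₀ v := by
      exact_mod_cast card_filter_union_le_copyCount ω₀ u v
    simp only [Small, Set.mem_ofPred_eq] at hu hv
    linarith
  · rw [List.toFinset_card_of_nodup hl, ← mul_assoc]
    norm_num only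
    have hq0 : 0 ≤ q := hp.trans hpq
    refine mul_le_mul_of_nonneg_left (Real.exp_le_exp.2 (neg_le_neg ?_)) (by positivity)
    have h3 : (3 : ℝ) * mr H n 1 ≤ 2 * (copiesAt H u ∪ copiesAt H v).card := by
      exact_mod_cast three_mul_mr_le hn huv
    have he := exp_neg_two_le
    calc 6 / 5 * (p * mr H n 1) = p * (4 / 5) * (3 / 2 * mr H n 1) := by ring
      _ ≤ p * (1 - Real.exp (-2)) * (copiesAt H u ∪ copiesAt H v).card := by
        refine mul_le_mul (mul_le_mul_of_nonneg_left (by linarith) hp) (by linarith)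
          (by positivity) (mul_nonneg hp (by linarith))

/-- First moment bound over chains of at most `6` copies. -/
lemma coupleProb_smallLinked_le {p q : ℝ} (hp : 0 ≤ p) (hpq : p ≤ q) (hq : q ≤ 1)
    (hn : 2 * k ≤ n) :
    coupleProb H n p q SmallLinked ≤
      n * ∑ ℓ ∈ Finset.range 7, ((mr H n 1 * k : ℕ) : ℝ) ^ ℓ *
        (Real.exp (4 * Real.log (Real.log n)) * (Real.exp 1 * q) ^ ℓ *
          Real.exp (-(6 / 5 * (p * mr H n 1)))) := by
  classical
  have hq0 : 0 ≤ q := hp.trans hpq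
  refine (coupleProb_mono hp hpq hq (Q := fun ω₀ ω₂ => ∃ u ∈ (Finset.univ : Finset (Fin n)),
    ∃ ℓ ∈ Finset.range 7, ∃ x ∈ chains H ℓ u, (u ≠ x.2 ∧ x.1.Nodup) ∧
      u ∈ Small ω₀ ∧ x.2 ∈ Small ω₀ ∧ ∀ c ∈ x.1, ω₂ c = true) ?_).trans ?_
  · rintro ω₀ ω₂ ⟨u, v, hu, hv, huv, 𝒞, hcard, hsel, hreach⟩
    obtain ⟨m, l, hl, hnd, hsub⟩ := exists_nodup_mem_chains hreach
    refine ⟨u, Finset.mem_univ _, m, ?_, (l, v), hl, ⟨huv, hnd⟩, hu, hv,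
      fun c hc => hsel c (hsub c hc)⟩
    have h1 : l.toFinset.card ≤ 𝒞.card :=
      Finset.card_le_card fun c hc => hsub c (List.mem_toFinset.1 hc)
    rw [List.toFinset_card_of_nodup hnd, length_eq_of_mem_chains hl] at h1
    exact Finset.mem_range.2 (by omega)
  · refine (coupleProb_exists_le hp hpq hq _ _).trans ?_
    refine (Finset.sum_le_card_nsmul _ _ _ fun u _ => ?_).trans_eq
      (by rw [Finset.card_univ, Fintype.card_fin, nsmul_eq_mul])
    refine (coupleProb_exists_le hp hpq hq _ _).trans (Finset.sum_le_sum fun ℓ _ => ?_)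
    refine (coupleProb_exists_le hp hpq hq _ _).trans
      ((Finset.sum_le_card_nsmul _ _ (Real.exp (4 * Real.log (Real.log n)) *
        (Real.exp 1 * q) ^ ℓ * Real.exp (-(6 / 5 * (p * mr H n 1)))) ?_).trans ?_)
    · rintro ⟨l, v⟩ hx
      by_cases h : u ≠ v ∧ l.Nodup
      · have := coupleProb_chain_le hp hpq hq hn h.1 h.2
        rw [length_eq_of_mem_chains hx] at this
        exact (coupleProb_mono hp hpq hq fun _ _ h => h.2).trans this
      · have : coupleProb H n p q (fun ω₀ ω₂ => (u ≠ v ∧ l.Nodup) ∧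
            u ∈ Small ω₀ ∧ v ∈ Small ω₀ ∧ ∀ c ∈ l, ω₂ c = true) = 0 := by
          simp [coupleProb, h]
        exact this.le.trans (by positivity)
    · rw [nsmul_eq_mul]
      refine mul_le_mul_of_nonneg_right ?_ (by positivity)
      exact_mod_cast card_chains_le ℓ u

end Counting

/-- **Lemma (SMALL vertices are far apart).**  Under the coupling
`G(H,n,p_0) ⊆ G(H,n,p_2^+)`, w.h.p.: for every two distinct vertices
`u, v ∈ SMALL` (defined from `G(H,n,p_0)`) there is no family of at most `6`
copies of `H` present in `G(H,n,p_2^+)` whose union is connected and contains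
both `u` and `v`; consequently every two distinct vertices of `SMALL` are at
graph distance at least `7` in `G(H,n,p_2^+)` (every walk between them has
length at least `7`). -/
theorem small_far_apart {r : ℕ} (H : SimpleGraph (Fin r)) (hr : 0 < r)
    (hiso : ∀ v, (H.neighborSet v).Nonempty)
    (x : ℕ → ℝ) (hx : Tendsto x atTop atTop)
    (hx' : Tendsto (fun n => x n / Real.log (Real.log n)) atTop (nhds 0)) :
    Tendsto (fun n => coupleProb H n (pZero H n) (pPlus H 2 x n)
      (fun ω₀ ω₂ =>
        (∀ u v : Fin n, u ∈ Small ω₀ → v ∈ Small ω₀ → u ≠ v →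
          ¬ ∃ 𝒞 : Finset (Copy H n), 𝒞.card ≤ 6 ∧ (∀ c ∈ 𝒞, ω₂ c = true) ∧
            u ∈ (𝒞.sup Subtype.val).support ∧ v ∈ (𝒞.sup Subtype.val).support ∧
            (∀ a ∈ (𝒞.sup Subtype.val).support, ∀ b ∈ (𝒞.sup Subtype.val).support,
              (𝒞.sup Subtype.val).Reachable a b)) ∧
        (∀ u v : Fin n, u ∈ Small ω₀ → v ∈ Small ω₀ → u ≠ v →
          ∀ w : (graphOf ω₂).Walk u v, 7 ≤ w.length)))
      atTop (nhds 1) := by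
  set m : ℕ → ℝ := fun n => (mr H n 1 : ℝ) with hm
  set D : ℝ := (deltad H 2 : ℝ) with hD
  have hr1 : (1 : ℝ) ≤ r := by exact_mod_cast hr
  have hlog : Tendsto (fun n : ℕ => Real.log n) atTop atTop :=
    Real.tendsto_log_atTop.comp tendsto_natCast_atTop_atTop
  have hloglog : Tendsto (fun n : ℕ => Real.log (Real.log n)) atTop atTop :=
    Real.tendsto_log_atTop.comp hlog
  have hsmall : ∀ ε : ℝ, 0 < ε → ∀ᶠ n : ℕ in atTop, Real.log (Real.log n) ≤ ε * Real.log n := by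
    intro ε hε
    filter_upwards [hlog.eventually (Real.isLittleO_log_id_atTop.def hε),
      hlog.eventually_ge_atTop 0] with n h1 h2
    simp only [id, Real.norm_eq_abs, abs_of_nonneg h2] at h1
    exact (le_abs_self _).trans h1
  have hlin : ∀ᶠ n : ℕ in atTop, Real.log n ≤ 1 / (6 * r) * n := by
    have hε : (0 : ℝ) < 1 / (6 * r) := by positivity
    filter_upwards [tendsto_natCast_atTop_atTop.eventually
      (Real.isLittleO_log_id_atTop.def hε)] with n h1
    simp only [id, Real.norm_eq_abs, Nat.abs_cast] at h1
    exact (le_abs_self _).trans h1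
  have hbound : ∀ᶠ n : ℕ in atTop,
      (0 ≤ pZero H n ∧ pZero H n ≤ pPlus H 2 x n ∧ pPlus H 2 x n ≤ 1) ∧
      coupleProb H n (pZero H n) (pPlus H 2 x n) SmallLinked ≤
        7 * (9 * r) ^ 6 * Real.exp (-(1 / 10 * Real.log n)) := by
    filter_upwards [eventually_ge_atTop (2 * r), eventually_ge_atTop 2,
      hlog.eventually_ge_atTop 1, hloglog.eventually_ge_atTop 1,
      hsmall (1 / 124) (by norm_num), hsmall (1 / (D + 1)) (by positivity), hlin,
      hx.eventually_ge_atTop 0, hx'.eventually_le_const (show (0 : ℝ) < 1 by norm_num)]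
      with n hn2r hn2 hL1 hLL1 hLL hDL hnlin hx0 hxL
    set Ln := Real.log n with hLn
    set L := Real.log Ln with hL
    have hxL' : x n ≤ L := by
      rw [div_le_one (by linarith)] at hxL; exact hxL
    have hDL' : D * L ≤ Ln := by
      have : (D + 1) * L ≤ Ln := by
        rw [one_div, ← div_eq_inv_mul, le_div_iff₀ (by positivity)] at hDL
        linarith
      nlinarith
    have hmn : (n : ℝ) - 1 ≤ r * m n := by
      have h := le_mul_mr (H := H) hr hiso (by omega) hn2
      have h' : n ≤ r * mr H n 1 + 1 := by
        have : (r - 1) * mr H n 1 ≤ r * mr H n 1 := Nat.mul_le_mul_right _ (by omega)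
        omega
      have : (n : ℝ) ≤ r * mr H n 1 + 1 := by exact_mod_cast h'
      simp only [hm]; linarith
    have hn2' : (2 : ℝ) ≤ n := by exact_mod_cast hn2
    have hm3 : 3 * Ln ≤ m n := by
      rw [one_div, ← div_eq_inv_mul, le_div_iff₀ (by positivity)] at hnlin
      have : r * (3 * Ln) ≤ r * m n := by linarith
      exact le_of_mul_le_mul_left this (by linarith)
    have hm0 : 0 < m n := by linarith
    have hp : pZero H n * m n = Ln - 2 * L := div_mul_cancel₀ _ hm0.ne'
    have hqm : pPlus H 2 x n * m n = Ln + D * L + x n := div_mul_cancel₀ _ hm0.ne'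
    have hq3 : pPlus H 2 x n * m n ≤ 3 * Ln := by rw [hqm]; linarith
    have hp0 : 0 ≤ pZero H n := div_nonneg (by linarith) hm0.le
    have hD0 : 0 ≤ D := Nat.cast_nonneg _
    have hpq : pZero H n ≤ pPlus H 2 x n := by
      refine le_of_mul_le_mul_right ?_ hm0
      rw [hp, hqm]
      nlinarith
    have hq1 : pPlus H 2 x n ≤ 1 := by
      refine le_of_mul_le_mul_right ?_ hm0
      linarith
    refine ⟨⟨hp0, hpq, hq1⟩, (coupleProb_smallLinked_le hp0 hpq hq1 hn2r).trans ?_⟩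
    have hq0 : 0 ≤ pPlus H 2 x n := hp0.trans hpq
    have hbase : (m n * r) * (Real.exp 1 * pPlus H 2 x n) ≤ 9 * r * Ln := by
      have he : Real.exp 1 ≤ 3 := by have := Real.exp_one_lt_d9; linarith
      calc (m n * r) * (Real.exp 1 * pPlus H 2 x n)
          = r * (Real.exp 1 * (pPlus H 2 x n * m n)) := by ring
        _ ≤ r * (3 * (3 * Ln)) := by gcongr
        _ = _ := by ring
    have hterm : ∀ ℓ ∈ Finset.range 7, ((mr H n 1 * r : ℕ) : ℝ) ^ ℓ *
        (Real.exp (4 * L) * (Real.exp 1 * pPlus H 2 x n) ^ ℓ *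
          Real.exp (-(6 / 5 * (pZero H n * mr H n 1)))) ≤
        (9 * r * Ln) ^ 6 * Real.exp (32 / 5 * L - 6 / 5 * Ln) := by
      intro ℓ hℓ
      have hℓ6 : ℓ ≤ 6 := by have := Finset.mem_range.1 hℓ; omega
      have h1 : 1 ≤ 9 * r * Ln := by nlinarith
      have hp' : pZero H n * mr H n 1 = Ln - 2 * L := hp
      calc _ = ((m n * r) * (Real.exp 1 * pPlus H 2 x n)) ^ ℓ *
            (Real.exp (4 * L) * Real.exp (-(6 / 5 * (Ln - 2 * L)))) := by
            rw [hp', mul_pow (m n * r)]; push_cast; simp only [hm]; ring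
        _ ≤ (9 * r * Ln) ^ 6 * (Real.exp (4 * L) * Real.exp (-(6 / 5 * (Ln - 2 * L)))) := by
            refine mul_le_mul_of_nonneg_right ?_ (by positivity)
            exact (pow_le_pow_left₀ (by positivity) hbase ℓ).trans (pow_le_pow_right₀ h1 hℓ6)
        _ = _ := by rw [← Real.exp_add]; congr 2; ring
    have hexpL : Real.exp L = Ln := Real.exp_log (by linarith)
    have hexpn : Real.exp Ln = n := Real.exp_log (by linarith)
    calc _ ≤ (n : ℝ) * (7 * ((9 * r * Ln) ^ 6 * Real.exp (32 / 5 * L - 6 / 5 * Ln))) := by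
          refine mul_le_mul_of_nonneg_left ?_ (by linarith)
          refine (Finset.sum_le_card_nsmul _ _ _ hterm).trans_eq ?_
          rw [Finset.card_range, nsmul_eq_mul]; norm_num
      _ = 7 * (9 * r) ^ 6 * (Real.exp Ln * Real.exp L ^ 6 *
            Real.exp (32 / 5 * L - 6 / 5 * Ln)) := by rw [hexpL, hexpn]; ring
      _ = 7 * (9 * r) ^ 6 * Real.exp (62 / 5 * L - 1 / 5 * Ln) := by
          rw [← Real.exp_nat_mul, ← Real.exp_add, ← Real.exp_add]
          congr 2; push_cast; ring
      _ ≤ _ := by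
          refine mul_le_mul_of_nonneg_left (Real.exp_le_exp.2 ?_) (by positivity)
          linarith
  have hlim : Tendsto (fun n : ℕ => 1 - 7 * (9 * (r : ℝ)) ^ 6 *
      Real.exp (-(1 / 10 * Real.log n))) atTop (nhds 1) := by
    have h1 : Tendsto (fun n : ℕ => Real.exp (-(1 / 10 * Real.log n))) atTop (nhds 0) :=
      Real.tendsto_exp_neg_atTop_nhds_zero.comp (hlog.const_mul_atTop (by norm_num))
    simpa using (h1.const_mul (7 * (9 * (r : ℝ)) ^ 6)).const_sub 1
  refine tendsto_of_tendsto_of_tendsto_of_le_of_le' hlim tendsto_const_nhds ?_ ?_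
  · filter_upwards [hbound] with n ⟨⟨hp0, hpq, hq1⟩, hb⟩
    rw [coupleProb_not]
    refine sub_le_sub_left ((coupleProb_mono hp0 hpq hq1 ?_).trans hb) 1
    intro ω₀ ω₂ h
    by_contra hnot
    refine h ⟨fun u v hu hv huv ⟨𝒞, hcard, hsel, husupp, hvsupp, hconn⟩ => hnot
      ⟨u, v, hu, hv, huv, 𝒞, hcard, hsel, hconn u husupp v hvsupp⟩, fun u v hu hv huv w => ?_⟩
    by_contra hlen
    obtain ⟨𝒞, hcard, hsel, hreach⟩ := exists_reachable_of_walk w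
    exact hnot ⟨u, v, hu, hv, huv, 𝒞, by omega, hsel, hreach⟩
  · filter_upwards [hbound] with n ⟨⟨hp0, hpq, hq1⟩, _⟩
    rw [coupleProb_not]
    exact sub_le_self _ (coupleProb_nonneg hp0 hpq hq1 _)

end RandomMotif
end

section
/- Let H be a fixed graph and p_0 = (ln n − 2 ln ln n)/m_1(H). Then with probability tending to 1 as n → ∞, the number of vertices of [n] that are contained in fewer than ln ln n of the copies of H present in G(H,n,p_0) is at most n^{0.1}; that is, |SMALL| ≤ n^{0.1} w.h.p. -/
open Filter

namespace RandomMotif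

open Classical in
/-- The moment generating function of the number of selected copies through `v`. -/
theorem sum_weight_mul_pow_copyCount {k n : ℕ} (H : SimpleGraph (Fin k)) (p t : ℝ) (v : Fin n) :
    ∑ ω : Copy H n → Bool, (∏ c : Copy H n, if ω c then p else 1 - p) * t ^ copyCount ω v =
      (1 - p + p * t) ^ Nat.card {c : Copy H n // v ∈ c.1.support} := by
  have hpow (ω : Copy H n → Bool) :
      t ^ copyCount ω v = ∏ c : Copy H n, if ω c = true ∧ v ∈ c.1.support then t else 1 := by
    rw [Finset.prod_ite, Finset.prod_const, Finset.prod_const_one, mul_one, copyCount,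
      Nat.card_eq_fintype_card, Fintype.card_subtype]
  have hbool (c : Copy H n) :
      ∑ b : Bool, (if b then p else 1 - p) * (if b = true ∧ v ∈ c.1.support then t else 1) =
        if v ∈ c.1.support then 1 - p + p * t else 1 := by
    by_cases h : v ∈ c.1.support
    · simp [h]
      ring
    · simp [h]
  calc
    _ = ∑ ω : Copy H n → Bool, ∏ c : Copy H n, (if ω c then p else 1 - p) *
          (if ω c = true ∧ v ∈ c.1.support then t else 1) := by
      refine Finset.sum_congr rfl fun ω _ => ?_
      rw [hpow, ← Finset.prod_mul_distrib]
    _ = ∏ c : Copy H n, ∑ b : Bool, (if b then p else 1 - p) *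
          (if b = true ∧ v ∈ c.1.support then t else 1) := by
      rw [Finset.prod_univ_sum, Fintype.piFinset_univ]
    _ = _ := by
      simp_rw [hbool]
      rw [Finset.prod_ite, Finset.prod_const, Finset.prod_const_one, mul_one,
        Nat.card_eq_fintype_card, Fintype.card_subtype]

open Classical in
/-- The selection weights sum to one. -/
theorem sum_weight {k : ℕ} (H : SimpleGraph (Fin k)) (n : ℕ) (p : ℝ) :
    ∑ ω : Copy H n → Bool, (∏ c : Copy H n, if ω c then p else 1 - p) = 1 := by
  have h := (Finset.prod_univ_sum (fun _ : Copy H n => (Finset.univ : Finset Bool))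
    (fun _ b => if b then p else 1 - p)).symm
  rw [Fintype.piFinset_univ] at h
  convert h using 1
  simp

/-- At least as many copies pass through any vertex as through the first one. -/
theorem mr_one_le {k n : ℕ} (H : SimpleGraph (Fin k)) (v : Fin n) :
    mr H n 1 ≤ Nat.card {c : Copy H n // v ∈ c.1.support} := by
  have hn : 0 < n := v.pos
  let σ : Fin n ≃ Fin n := Equiv.swap ⟨0, hn⟩ v
  refine Nat.card_le_card_of_injective
    (fun G : {G : SimpleGraph (Fin n) // IsCopy H G ∧ ∃ w ∈ G.support, (w : ℕ) < 1} =>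
      (⟨⟨G.1.map σ.toEmbedding, ?_⟩, ?_⟩ : {c : Copy H n // v ∈ c.1.support})) ?_
  · obtain ⟨f, hf⟩ := G.2.1
    exact ⟨f.trans σ.toEmbedding, by rw [hf, SimpleGraph.map_map]; rfl⟩
  · obtain ⟨w, ⟨u, hu⟩, hw⟩ := G.2.2
    have hw0 : w = ⟨0, hn⟩ := Fin.ext (by simpa using hw)
    exact ⟨σ u, (SimpleGraph.map_adj _ _ _ _).2 ⟨w, u, hu, by simp [hw0, σ], rfl⟩⟩
  · intro G G' h
    exact Subtype.ext (SimpleGraph.map_injective σ.toEmbedding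
      (congrArg (fun c => c.1.1) h))

/-- The copies through the first vertex cover all vertices, hence there are many of them. -/
theorem le_mul_mr_one {k n : ℕ} (H : SimpleGraph (Fin k)) (hk : 0 < k)
    (hiso : ∀ v, (H.neighborSet v).Nonempty) (hkn : k ≤ n) : n ≤ k * mr H n 1 := by
  classical
  have hn : 0 < n := hk.trans_le hkn
  let T := {G : SimpleGraph (Fin n) // IsCopy H G ∧ ∃ w ∈ G.support, (w : ℕ) < 1}
  have hsupp (f : Fin k ↪ Fin n) (a : Fin k) : f a ∈ (H.map f).support := by
    obtain ⟨b, hb⟩ := hiso a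
    exact ⟨f b, (SimpleGraph.map_adj _ _ _ _).2 ⟨a, b, hb, rfl, rfl⟩⟩
  have hcover (x : Fin n) : ∃ (G : T) (a : Fin k), G.2.1.choose a = x := by
    obtain ⟨b, hb⟩ := hiso ⟨0, hk⟩
    have hne : b ≠ ⟨0, hk⟩ := fun h => H.ne_of_adj hb h.symm
    obtain ⟨f, hf0, c, hfx⟩ :
        ∃ f : Fin k ↪ Fin n, f ⟨0, hk⟩ = ⟨0, hn⟩ ∧ ∃ c, f c = x := by
      by_cases hx : x = ⟨0, hn⟩
      · exact ⟨Fin.castLEEmb hkn, rfl, ⟨0, hk⟩, hx.symm⟩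
      · refine ⟨(Fin.castLEEmb hkn).trans
          (Equiv.swap (Fin.castLEEmb hkn b) x).toEmbedding, ?_, b, ?_⟩
        · refine Equiv.swap_apply_of_ne_of_ne ?_ ?_
          · exact fun h => hne ((Fin.castLEEmb hkn).injective h).symm
          · exact fun h => hx h.symm
        · exact Equiv.swap_apply_left _ _
    let G : T := ⟨H.map f, ⟨f, rfl⟩, ⟨0, hn⟩, hf0 ▸ hsupp f _, by simp⟩
    have hG : H.map f = H.map G.2.1.choose := G.2.1.choose_spec
    have hx : x ∈ (H.map G.2.1.choose).support := hG ▸ hfx ▸ hsupp f c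
    obtain ⟨y, hy⟩ := hx
    obtain ⟨a, _, _, ha, _⟩ := (SimpleGraph.map_adj _ _ _ _).1 hy
    exact ⟨G, a, ha⟩
  have h := Nat.card_le_card_of_surjective
    (fun q : Fin k × T => q.2.2.1.choose q.1) fun x => by
      obtain ⟨G, a, h⟩ := hcover x
      exact ⟨(a, G), h⟩
  rw [Nat.card_prod, Nat.card_fin, Nat.card_fin] at h
  exact h

/-- Markov's inequality combined with the Chernoff bound for each vertex. -/
theorem one_sub_selProb_small_le {k n : ℕ} (H : SimpleGraph (Fin k)) {p N : ℝ}
    (hp0 : 0 ≤ p) (hp1 : p ≤ 1) (hN : 0 < N) (hL : 0 ≤ Real.log (Real.log n)) :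
    1 - selProb H n p (fun ω => ((Small ω).ncard : ℝ) ≤ N) ≤
      n * (Real.exp (Real.log (Real.log n) ^ 2) *
        Real.exp (-(p * mr H n 1 * (1 - Real.exp (-Real.log (Real.log n)))))) / N := by
  classical
  set L := Real.log (Real.log n) with hLdef
  set t := Real.exp (-L) with ht
  have ht0 : 0 ≤ t := (Real.exp_pos _).le
  have ht1 : t ≤ 1 := Real.exp_le_one_iff.2 (by linarith)
  have hw (ω : Copy H n → Bool) : 0 ≤ ∏ c : Copy H n, if ω c then p else 1 - p :=
    Finset.prod_nonneg fun c _ => by split_ifs <;> linarith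
  have hcount (ω : Copy H n → Bool) :
      ((Small ω).ncard : ℝ) ≤ ∑ v : Fin n, Real.exp (L ^ 2) * t ^ copyCount ω v := by
    rw [Set.ncard_eq_toFinset_card', Finset.card_eq_sum_ones, Nat.cast_sum]
    refine (Finset.sum_le_sum fun v hv => ?_).trans
      (Finset.sum_le_sum_of_subset_of_nonneg (Finset.subset_univ _) fun v _ _ => by positivity)
    have hv' : (copyCount ω v : ℝ) < L := by
      have h : v ∈ Small ω := Set.mem_toFinset.1 hv
      exact h
    rw [ht, ← Real.exp_nat_mul, ← Real.exp_add, Nat.cast_one]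
    exact Real.one_le_exp (by nlinarith)
  have hvertex (v : Fin n) :
      ∑ ω : Copy H n → Bool, (∏ c : Copy H n, if ω c then p else 1 - p) * t ^ copyCount ω v ≤
        Real.exp (-(p * mr H n 1 * (1 - t))) := by
    rw [sum_weight_mul_pow_copyCount]
    have hle : 1 - p + p * t ≤ Real.exp (-(p * (1 - t))) := by
      have := Real.add_one_le_exp (-(p * (1 - t)))
      linarith
    have h0 : 0 ≤ 1 - p + p * t := by nlinarith [mul_nonneg hp0 ht0]
    have hm : (mr H n 1 : ℝ) ≤ (Nat.card {c : Copy H n // v ∈ c.1.support} : ℝ) := by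
      exact_mod_cast mr_one_le H v
    refine (pow_le_pow_left₀ h0 hle _).trans ?_
    rw [← Real.exp_nat_mul]
    refine Real.exp_le_exp.2 ?_
    nlinarith [mul_le_mul_of_nonneg_right hm (mul_nonneg hp0 (sub_nonneg.2 ht1))]
  calc
    1 - selProb H n p (fun ω => ((Small ω).ncard : ℝ) ≤ N)
        = ∑ ω : Copy H n → Bool, (∏ c : Copy H n, if ω c then p else 1 - p) *
            (1 - if ((Small ω).ncard : ℝ) ≤ N then 1 else 0) := by
      simp_rw [mul_sub, mul_one, Finset.sum_sub_distrib, sum_weight]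
      congr 1
    _ ≤ ∑ ω : Copy H n → Bool, (∏ c : Copy H n, if ω c then p else 1 - p) *
            ((∑ v : Fin n, Real.exp (L ^ 2) * t ^ copyCount ω v) / N) := by
      refine Finset.sum_le_sum fun ω _ => mul_le_mul_of_nonneg_left ?_ (hw ω)
      split_ifs with h
      · rw [sub_self]; positivity
      · rw [sub_zero, le_div_iff₀ hN, one_mul]
        exact (not_le.1 h).le.trans (hcount ω)
    _ = (∑ v : Fin n, Real.exp (L ^ 2) * ∑ ω : Copy H n → Bool,
          (∏ c : Copy H n, if ω c then p else 1 - p) * t ^ copyCount ω v) / N := by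
      simp_rw [Finset.mul_sum]
      rw [Finset.sum_comm, Finset.sum_div]
      refine Finset.sum_congr rfl fun ω _ => ?_
      rw [← mul_div_assoc, Finset.mul_sum]
      congr 1
      exact Finset.sum_congr rfl fun v _ => by ring
    _ ≤ (∑ v : Fin n, Real.exp (L ^ 2) * Real.exp (-(p * mr H n 1 * (1 - t)))) / N := by
      gcongr with v
      exact hvertex v
    _ = _ := by rw [Finset.sum_const, Finset.card_univ, Fintype.card_fin, nsmul_eq_mul]

/-- Selection probabilities are at most one. -/
theorem selProb_le_one {k n : ℕ} (H : SimpleGraph (Fin k)) {p : ℝ}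
    (hp0 : 0 ≤ p) (hp1 : p ≤ 1) (P : (Copy H n → Bool) → Prop) : selProb H n p P ≤ 1 := by
  classical
  rw [← sum_weight H n p, selProb]
  refine Finset.sum_le_sum fun ω _ => mul_le_of_le_one_right
    (Finset.prod_nonneg fun c _ => by split_ifs <;> linarith) ?_
  split_ifs <;> norm_num

/-- The exponential eventually dominates a quadratic. -/
theorem tendsto_exp_quadratic_sub_exp :
    Tendsto (fun x : ℝ => Real.exp (x ^ 2 + 2 * x + 1 - 0.1 * Real.exp x)) atTop (nhds 0) := by
  refine Real.tendsto_exp_atBot.comp ?_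
  have h := Real.tendsto_exp_div_pow_atTop 2
  refine tendsto_atBot_mono' _ ?_ tendsto_neg_atTop_atBot
  filter_upwards [h.eventually_ge_atTop 50, eventually_ge_atTop 1] with x hx hx1
  rw [le_div_iff₀ (by positivity)] at hx
  nlinarith

/-- **Lemma (SMALL is small).**  In `G(H,n,p_0)` with
`p_0 = (ln n - 2 ln ln n)/m_1(H)`, w.h.p. at most `n^0.1` vertices lie on fewer
than `ln ln n` of the selected copies of `H`. -/
theorem small_is_small {k : ℕ} (H : SimpleGraph (Fin k)) (hk : 0 < k)
    (hiso : ∀ v, (H.neighborSet v).Nonempty) :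
    Tendsto (fun n => selProb H n (pZero H n) (fun ω =>
        ((Small ω).ncard : ℝ) ≤ (n : ℝ) ^ (0.1 : ℝ)))
      atTop (nhds 1) := by
  have hnat : Tendsto (fun n : ℕ => (n : ℝ)) atTop atTop := tendsto_natCast_atTop_atTop
  have hlog : Tendsto (fun n : ℕ => Real.log n) atTop atTop := Real.tendsto_log_atTop.comp hnat
  have hloglog : Tendsto (fun n : ℕ => Real.log (Real.log n)) atTop atTop :=
    Real.tendsto_log_atTop.comp hlog
  have hbound := tendsto_exp_quadratic_sub_exp.comp hloglog
  have hsmall : ∀ᶠ n : ℕ in atTop, (k : ℝ) * Real.log n ≤ n := by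
    have h := (Real.isLittleO_log_id_atTop.comp_tendsto hnat).bound
      (show (0 : ℝ) < (k : ℝ)⁻¹ by positivity)
    filter_upwards [h, hlog.eventually_ge_atTop 0] with n hn hl
    simp only [Function.comp_apply, id, Real.norm_eq_abs, abs_of_nonneg hl, Nat.abs_cast] at hn
    rwa [inv_mul_eq_div, le_div_iff₀' (by positivity)] at hn
  have hev : ∀ᶠ n : ℕ in atTop, 0 ≤ pZero H n ∧ pZero H n ≤ 1 ∧
      1 - selProb H n (pZero H n) (fun ω => ((Small ω).ncard : ℝ) ≤ (n : ℝ) ^ (0.1 : ℝ)) ≤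
        Real.exp (Real.log (Real.log n) ^ 2 + 2 * Real.log (Real.log n) + 1 -
          0.1 * Real.exp (Real.log (Real.log n))) := by
    filter_upwards [hsmall, eventually_ge_atTop k, hlog.eventually_gt_atTop 0,
      hloglog.eventually_ge_atTop 1] with n hn hkn hl hL
    have hn0 : (0 : ℝ) < n := by exact_mod_cast hk.trans_le hkn
    have hk0 : (0 : ℝ) < k := by exact_mod_cast hk
    have hmr : (n : ℝ) ≤ k * mr H n 1 := by exact_mod_cast le_mul_mr_one H hk hiso hkn
    have hlogm : Real.log n ≤ mr H n 1 := le_of_mul_le_mul_left (hn.trans hmr) hk0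
    have hm0 : (0 : ℝ) < mr H n 1 := hl.trans_le hlogm
    have hexp : Real.exp (Real.log (Real.log n)) = Real.log n := Real.exp_log hl
    set L := Real.log (Real.log n) with hLdef
    have h2L : 2 * L ≤ Real.log n := by
      rw [← hexp]
      have := Real.add_one_le_exp (L - 1)
      have h1 := Real.add_one_le_exp (1 : ℝ)
      have h2 : Real.exp L = Real.exp (L - 1) * Real.exp 1 := by
        rw [← Real.exp_add, sub_add_cancel]
      nlinarith
    have hp0 : 0 ≤ pZero H n := div_nonneg (by linarith) hm0.le
    have hp1 : pZero H n ≤ 1 := (div_le_one hm0).2 (by linarith)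
    refine ⟨hp0, hp1, (one_sub_selProb_small_le H hp0 hp1 (Real.rpow_pos_of_pos hn0 _)
      (by linarith)).trans ?_⟩
    have hpm : pZero H n * mr H n 1 = Real.log n - 2 * L := div_mul_cancel₀ _ hm0.ne'
    have hinv : Real.exp (-L) * Real.log n = 1 := by
      rw [← hexp, ← Real.exp_add, neg_add_cancel, Real.exp_zero]
    rw [← hLdef, hpm, hexp, Real.rpow_def_of_pos hn0]
    conv_lhs => enter [1, 1]; rw [← Real.exp_log hn0]
    rw [← Real.exp_add, ← Real.exp_add, ← Real.exp_sub]
    refine Real.exp_le_exp.2 ?_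
    nlinarith [mul_nonneg (Real.exp_pos (-L)).le (show 0 ≤ L by linarith)]
  refine tendsto_of_tendsto_of_tendsto_of_le_of_le' (by simpa using hbound.const_sub 1)
    tendsto_const_nhds ?_ ?_
  · filter_upwards [hev] with n hn
    have := hn.2.2
    linarith
  · filter_upwards [hev] with n hn
    exact selProb_le_one H hn.1 hn.2.1 _

end RandomMotif
end
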